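/- Let f(X₁, X₂) = X₁⁴X₂² + X₁²X₂⁴ + 1 − 3X₁²X₂² (the Motzkin polynomial) and g(X₁, X₂) = X₁² + 1. Then there do not exist polynomials u₁,…,u_l, v₁,…,v_{l′} ∈ ℝ[X₁, X₂] with deg(v_j) ≤ 1 for every j and Σ_j v_j² ≠ 0 such that f · Σ_j v_j² = g · Σ_i u_i². -/

import Mathlib

open MvPolynomial

/-- If squares in `R` cannot cancel, no cancellation of leading terms occurs in a sum of squares
of polynomials over `R`. -/
theorem natDegree_le_of_sum_sq {R ι : Type*} [CommRing R] [Fintype ι]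
    (hR : ∀ a : ι → R, ∑ i, a i ^ 2 = 0 → ∀ i, a i = 0)
    (p : ι → Polynomial R) {d : ℕ} (h : (∑ i, p i ^ 2).natDegree ≤ 2 * d) (i : ι) :
    (p i).natDegree ≤ d := by
  by_contra! hi
  obtain ⟨k, -, hk⟩ := Finset.exists_max_image Finset.univ (fun j => (p j).natDegree)
    ⟨i, Finset.mem_univ i⟩
  have hdk : d < (p k).natDegree := hi.trans_le (hk i (Finset.mem_univ i))
  have hsum : ∑ j, (p j).coeff (p k).natDegree ^ 2 = 0 := by
    rw [← Polynomial.coeff_eq_zero_of_natDegree_lt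
      (h.trans_lt (by lia : 2 * d < 2 * (p k).natDegree)), Polynomial.finsetSum_coeff]
    exact Finset.sum_congr rfl fun j hj => (Polynomial.coeff_pow_of_natDegree_le (hk j hj)).symm
  have hp : p k = 0 := Polynomial.leadingCoeff_eq_zero.mp (hR _ hsum k)
  simp [hp] at hdk

theorem Real.eq_zero_of_sum_sq_eq_zero {ι : Type*} [Fintype ι] (a : ι → ℝ)
    (h : ∑ i, a i ^ 2 = 0) (i : ι) : a i = 0 := by
  simpa using (Finset.sum_eq_zero_iff_of_nonneg fun j _ => sq_nonneg (a j)).mp h i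
    (Finset.mem_univ i)

theorem Polynomial.eq_zero_of_sum_sq_eq_zero {ι : Type*} [Fintype ι] (p : ι → Polynomial ℝ)
    (h : ∑ i, p i ^ 2 = 0) (i : ι) : p i = 0 := by
  refine Polynomial.funext fun x => ?_
  have hx := congrArg (Polynomial.eval x) h
  simp only [Polynomial.eval_finsetSum, Polynomial.eval_pow, Polynomial.eval_zero] at hx ⊢
  exact Real.eq_zero_of_sum_sq_eq_zero _ hx i

/-- No positive multiple of the Motzkin polynomial is a sum of squares; here the first variable
is `C X` and the second is `X`. -/
theorem motzkin_ne_sum_sq {ι : Type*} [Fintype ι] {A : ℝ} (hA : 0 < A)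
    (p : ι → Polynomial (Polynomial ℝ)) :
    Polynomial.C (Polynomial.C A) *
      (Polynomial.C Polynomial.X ^ 4 * Polynomial.X ^ 2 +
        Polynomial.C Polynomial.X ^ 2 * Polynomial.X ^ 4 + 1 -
        3 * Polynomial.C Polynomial.X ^ 2 * Polynomial.X ^ 2) ≠ ∑ i, p i ^ 2 := by
  intro h
  replace h : ∑ i, p i ^ 2 =
      Polynomial.C (Polynomial.C A * Polynomial.X ^ 2) * Polynomial.X ^ 4 +
      Polynomial.C (Polynomial.C A * Polynomial.X ^ 4 - Polynomial.C (3 * A) * Polynomial.X ^ 2) *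
        Polynomial.X ^ 2 + Polynomial.C (Polynomial.C A) := by
    rw [← h]
    simp only [map_mul, map_sub, map_pow, map_ofNat]
    ring
  have hY : ∀ i, (p i).natDegree ≤ 2 := by
    refine natDegree_le_of_sum_sq Polynomial.eq_zero_of_sum_sq_eq_zero p ?_
    rw [h]
    compute_degree
  have hX0 : ∀ i, ((p i).coeff 0).natDegree ≤ 0 := by
    refine natDegree_le_of_sum_sq Real.eq_zero_of_sum_sq_eq_zero _ ?_
    have h0 := congrArg (fun q => Polynomial.coeff q 0) h
    simp [Polynomial.coeff_X_pow, sq, Polynomial.mul_coeff_zero] at h0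
    simp [sq, h0]
  have hY0 : ∀ i, ((p i).map (Polynomial.evalRingHom 0)).natDegree ≤ 0 := by
    refine natDegree_le_of_sum_sq Real.eq_zero_of_sum_sq_eq_zero _ ?_
    have h0 := congrArg (Polynomial.map (Polynomial.evalRingHom 0)) h
    simp [Polynomial.map_sum] at h0
    simp [h0]
  have hX2 : ∀ i, ((p i).coeff 2).natDegree ≤ 1 := by
    refine natDegree_le_of_sum_sq Real.eq_zero_of_sum_sq_eq_zero _ ?_
    have h0 := congrArg (fun q => Polynomial.coeff q 4) h
    simp only [Polynomial.finsetSum_coeff] at h0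
    rw [Finset.sum_congr rfl fun i _ =>
      Polynomial.coeff_pow_of_natDegree_le (m := 2) (hY i)] at h0
    rw [h0]
    simp only [Polynomial.coeff_add, Polynomial.coeff_C_mul, Polynomial.coeff_X_pow,
      Polynomial.coeff_C, Nat.reduceEqDiff, OfNat.ofNat_ne_zero, if_true,
      if_false, mul_one, mul_zero, add_zero]
    compute_degree
  have c00 (i a) (ha : 0 < a) : ((p i).coeff 0).coeff a = 0 :=
    Polynomial.coeff_eq_zero_of_natDegree_lt ((hX0 i).trans_lt ha)
  have c0 (i b) (hb : 0 < b) : ((p i).coeff b).coeff 0 = 0 := by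
    have := Polynomial.coeff_eq_zero_of_natDegree_lt ((hY0 i).trans_lt hb)
    rwa [Polynomial.coeff_map, Polynomial.coe_evalRingHom, ← Polynomial.coeff_zero_eq_eval_zero]
      at this
  have c22 (i) : ((p i).coeff 2).coeff 2 = 0 :=
    Polynomial.coeff_eq_zero_of_natDegree_lt ((hX2 i).trans_lt one_lt_two)
  have hsum : ∑ i, (((p i).coeff 1).coeff 1) ^ 2 = -(3 * A) := by
    have h0 := congrArg (fun q => (Polynomial.coeff q 2).coeff 2) h
    simp only [Polynomial.finsetSum_coeff] at h0
    rw [Finset.sum_congr rfl fun i _ => show ((p i ^ 2).coeff 2).coeff 2 =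
        (((p i).coeff 1).coeff 1) ^ 2 by
      simp [sq, Polynomial.coeff_mul, Finset.Nat.antidiagonal_succ, c00, c0, c22]] at h0
    rw [h0]
    simp only [Polynomial.coeff_add, Polynomial.coeff_C_mul, Polynomial.coeff_X_pow,
      Polynomial.coeff_C, Nat.reduceEqDiff, OfNat.ofNat_ne_zero, if_true, if_false, mul_one,
      mul_zero, add_zero, zero_add, Polynomial.coeff_sub, zero_sub]
  have : 0 ≤ ∑ i, (((p i).coeff 1).coeff 1) ^ 2 := Finset.sum_nonneg fun i _ => sq_nonneg _
  linarith

theorem MvPolynomial.exists_eq_of_totalDegree_le_one {R : Type*} [CommSemiring R]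
    (p : MvPolynomial (Fin 2) R) (hp : p.totalDegree ≤ 1) :
    ∃ a b c : R, p = C a + C b * X 0 + C c * X 1 := by
  classical
  refine ⟨p.coeff 0, p.coeff (Finsupp.single 0 1), p.coeff (Finsupp.single 1 1), ?_⟩
  ext m
  by_cases hm : m.degree ≤ 1
  · have h : m 0 + m 1 ≤ 1 := by simpa [Finsupp.degree_eq_sum] using hm
    have hm : m = 0 ∨ m = Finsupp.single 0 1 ∨ m = Finsupp.single 1 1 := by
      simp only [Finsupp.ext_iff, Fin.forall_fin_two]
      simp
      lia
    rcases hm with rfl | rfl | rfl <;>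
      simp [coeff_C_mul, coeff_X, coeff_C, Finsupp.single_left_inj,
        eq_comm (a := (0 : Fin 2 →₀ ℕ))]
  · rw [coeff_eq_zero_of_totalDegree_lt (lt_of_le_of_lt hp (not_le.mp hm))]
    have h0 : (0 : Fin 2 →₀ ℕ) ≠ m := by rintro rfl; simp at hm
    have h1 (i : Fin 2) : Finsupp.single i 1 ≠ m := by rintro rfl; simp at hm
    simp [coeff_C_mul, coeff_X, coeff_C, h0, h1]

/-- for the Motzkin polynomial
`f = X₁⁴X₂² + X₁²X₂⁴ + 1 − 3X₁²X₂²` and `g = X₁² + 1`, there are no polynomials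
`u₁,…,u_l, v₁,…,v_{l'} ∈ ℝ[X₁,X₂]` with `deg(vⱼ) ≤ 1` for all `j` and
`Σⱼ vⱼ² ≠ 0` such that `f · Σⱼ vⱼ² = g · Σᵢ uᵢ²`. -/
theorem statement15 :
    ¬ ∃ (l l' : ℕ) (u : Fin l → MvPolynomial (Fin 2) ℝ)
        (v : Fin l' → MvPolynomial (Fin 2) ℝ),
        (∀ j, (v j).totalDegree ≤ 1) ∧ (∑ j, v j ^ 2) ≠ 0 ∧
        (X 0 ^ 4 * X 1 ^ 2 + X 0 ^ 2 * X 1 ^ 4 + 1 - 3 * X 0 ^ 2 * X 1 ^ 2 :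
          MvPolynomial (Fin 2) ℝ) * (∑ j, v j ^ 2) =
          (X 0 ^ 2 + 1) * ∑ i, u i ^ 2 := by
  rintro ⟨l, l', u, v, hdeg, hne, h⟩
  choose a b c hv using fun j => exists_eq_of_totalDegree_le_one (v j) (hdeg j)
  have hvan (y : ℝ) (hy : 1 + 4 * y ^ 2 - y ^ 4 ≠ 0) :
      ∑ j, ((a j : ℂ) + b j * Complex.I + c j * y) ^ 2 = 0 := by
    have hI := congrArg (aeval ![Complex.I, (y : ℂ)]) h
    simp only [hv, map_mul, map_sum, map_pow, map_add, map_sub, map_one, map_ofNat, aeval_X,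
      aeval_C, Matrix.cons_val_zero, Matrix.cons_val_one, Complex.coe_algebraMap] at hI
    rw [show Complex.I ^ 2 + 1 = 0 by simp, zero_mul] at hI
    refine (mul_eq_zero.mp hI).resolve_left ?_
    rw [Complex.I_sq, Complex.I_pow_four]
    intro h0
    exact hy (by exact_mod_cast (by linear_combination h0 :
      (1 + 4 * (y : ℂ) ^ 2 - (y : ℂ) ^ 4) = 0))
  have hre (y : ℝ) (hy : 1 + 4 * y ^ 2 - y ^ 4 ≠ 0) :
      ∑ j, ((a j + c j * y) ^ 2 - b j ^ 2) = 0 := by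
    have := congrArg Complex.re (hvan y hy)
    simpa [sq] using this
  have h0 := hre 0 (by norm_num)
  have hc : ∀ j, c j = 0 := by
    refine Real.eq_zero_of_sum_sq_eq_zero c ?_
    have h1 := hre 1 (by norm_num)
    have h2 := hre (-1) (by norm_num)
    have : ∑ j, c j ^ 2 = (∑ j, ((a j + c j * 1) ^ 2 - b j ^ 2) +
        ∑ j, ((a j + c j * (-1)) ^ 2 - b j ^ 2) - 2 * ∑ j, ((a j + c j * 0) ^ 2 - b j ^ 2)) / 2 := by
      rw [Finset.mul_sum, ← Finset.sum_add_distrib, ← Finset.sum_sub_distrib, Finset.sum_div]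
      exact Finset.sum_congr rfl fun j _ => by ring
    rw [this, h0, h1, h2]
    norm_num
  have hab : ∑ j, a j ^ 2 = ∑ j, b j ^ 2 := by
    simpa [Finset.sum_sub_distrib, sub_eq_zero] using h0
  have hprod : ∑ j, a j * b j = 0 := by
    have := congrArg Complex.im (hvan 0 (by norm_num))
    have h2 : ∑ j, 2 * (a j * b j) = 0 := by
      rw [← Complex.zero_im, ← this, Complex.im_sum]
      exact Finset.sum_congr rfl fun j _ => by simp [sq]; ring
    rw [← Finset.mul_sum] at h2
    linarith
  have hsq : ∑ j, v j ^ 2 = C (∑ j, a j ^ 2) * (X 0 ^ 2 + 1) := by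
    calc ∑ j, v j ^ 2
        = C (∑ j, a j ^ 2) + 2 * C (∑ j, a j * b j) * X 0 + C (∑ j, b j ^ 2) * X 0 ^ 2 := by
          simp only [map_sum, Finset.mul_sum, Finset.sum_mul, ← Finset.sum_add_distrib]
          refine Finset.sum_congr rfl fun j _ => ?_
          rw [hv, hc]
          simp only [map_zero, map_mul, map_pow]
          ring
      _ = _ := by rw [hprod, ← hab, map_zero]; ring
  have hA : 0 < ∑ j, a j ^ 2 := by
    refine (Finset.sum_nonneg fun j _ => sq_nonneg (a j)).lt_of_ne' fun hA => hne ?_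
    rw [hsq, hA, map_zero, zero_mul]
  have hg : (X 0 ^ 2 + 1 : MvPolynomial (Fin 2) ℝ) ≠ 0 := fun hg => by
    simpa using congrArg (eval 0) hg
  rw [hsq] at h
  have hf : C (∑ j, a j ^ 2) * (X 0 ^ 4 * X 1 ^ 2 + X 0 ^ 2 * X 1 ^ 4 + 1 -
      3 * X 0 ^ 2 * X 1 ^ 2) = ∑ i, u i ^ 2 :=
    mul_left_cancel₀ hg (by rw [← h]; ring)
  have hψ := congrArg
    (eval₂Hom (Polynomial.C.comp Polynomial.C) ![Polynomial.C Polynomial.X, Polynomial.X]) hf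
  simp only [map_mul, map_sum (eval₂Hom _ _) (fun i => u i ^ 2), map_pow, map_add, map_sub,
    map_one, map_ofNat, coe_eval₂Hom, eval₂_C, eval₂_X, RingHom.comp_apply,
    Matrix.cons_val_zero, Matrix.cons_val_one] at hψ
  exact motzkin_ne_sum_sq hA _ hψ
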